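/- arXiv:2102.07948 — 3 statements merged into one kernel-verified Lean document; each statement's English description precedes it below -/
import Mathlib

section
/- Let G be a finite simple graph and T a good template in G. Then any two proper 5-colorings of G that contain T are Kempe 5-equivalent. -/
namespace KempePaper

variable {V : Type*}

/-- A proper `k`-coloring: adjacent vertices receive distinct colors. -/
def Proper (G : SimpleGraph V) {k : ℕ} (c : V → Fin k) : Prop :=
  ∀ ⦃u v : V⦄, G.Adj u v → c u ≠ c v

/-- The subgraph of `G` induced by the vertices colored `α` or `β` under `c`
(as a graph on all of `V`, with edges only between such vertices). -/
def kempeGraph (G : SimpleGraph V) {k : ℕ} (c : V → Fin k) (α β : Fin k) :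
    SimpleGraph V :=
  SimpleGraph.fromRel (fun u v =>
    G.Adj u v ∧ (c u = α ∨ c u = β) ∧ (c v = α ∨ c v = β))

/-- `c₂` is obtained from `c₁` by a single Kempe swap: the colors `α` and `β`
are interchanged on the connected component (of the subgraph induced by the
vertices colored `α` or `β`) containing some vertex `w`, and nothing else changes. -/
def KempeStep (G : SimpleGraph V) {k : ℕ} (c₁ c₂ : V → Fin k) : Prop :=
  ∃ (α β : Fin k) (w : V),
    (∀ v : V, (kempeGraph G c₁ α β).Reachable w v → c₂ v = Equiv.swap α β (c₁ v)) ∧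
    (∀ v : V, ¬ (kempeGraph G c₁ α β).Reachable w v → c₂ v = c₁ v)

/-- Two `k`-colorings are Kempe `k`-equivalent if one can be obtained from the
other by a finite sequence of Kempe swaps. -/
def KempeEquiv (G : SimpleGraph V) {k : ℕ} (c₁ c₂ : V → Fin k) : Prop :=
  Relation.ReflTransGen (KempeStep G) c₁ c₂

/-- The triangulated toroidal grid `T[a×b]`. -/
def triGrid (a b : ℕ) : SimpleGraph (ZMod a × ZMod b) :=
  SimpleGraph.fromRel (fun u v =>
    u - v ∈ ({(0,1), (0,-1), (1,0), (-1,0), (1,-1), (-1,1)} : Set (ZMod a × ZMod b)))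

/-- `G` is `d`-degenerate: every nonempty finite set `S` of vertices contains a
vertex with at most `d` neighbors inside `S`. -/
def Degenerate (G : SimpleGraph V) (d : ℕ) : Prop :=
  ∀ S : Set V, S.Finite → S.Nonempty → ∃ v ∈ S, (S ∩ G.neighborSet v).ncard ≤ d

/-- `S` is an independent set in `G`. -/
def Indep (G : SimpleGraph V) (S : Set V) : Prop :=
  ∀ u ∈ S, ∀ v ∈ S, ¬ G.Adj u v

/-- The relation identifying all the vertices of `S`. -/
def identifyRel (S : Set V) (u v : V) : Prop :=
  u = v ∨ (u ∈ S ∧ v ∈ S)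

/-- The identification `G/S`: the vertices of `S` are merged into a single vertex,
and two distinct resulting vertices are adjacent iff some representatives are
adjacent in `G`. -/
def Identify (G : SimpleGraph V) (S : Set V) :
    SimpleGraph (Quot (identifyRel S)) :=
  SimpleGraph.fromRel (fun x y =>
    ∃ u v : V, Quot.mk (identifyRel S) u = x ∧ Quot.mk (identifyRel S) v = y ∧ G.Adj u v)

/-- A good 4-template: an independent set of exactly 4 vertices whose
identification yields a 4-degenerate graph. -/
def GoodFourTemplate (G : SimpleGraph V) (S : Set V) : Prop :=
  Indep G S ∧ S.ncard = 4 ∧ Degenerate (Identify G S) 4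

/-- A coloring is monochromatic on `S`. -/
def Mono {k : ℕ} (c : V → Fin k) (S : Set V) : Prop :=
  ∀ u ∈ S, ∀ v ∈ S, c u = c v

/-- `φ` is nice: it is Kempe 5-equivalent to a proper 5-coloring of `T[a×b]`
containing a good 4-template. -/
def Nice (a b : ℕ) (c : ZMod a × ZMod b → Fin 5) : Prop :=
  ∃ c' : ZMod a × ZMod b → Fin 5,
    Proper (triGrid a b) c' ∧ KempeEquiv (triGrid a b) c c' ∧
    ∃ S : Set (ZMod a × ZMod b), GoodFourTemplate (triGrid a b) S ∧ Mono c' S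

/-- The relation identifying the vertices within each color of the template `T`. -/
def contractRel (T : Set (Set V)) (u v : V) : Prop :=
  u = v ∨ ∃ C ∈ T, u ∈ C ∧ v ∈ C

/-- The contraction `G_T`: the vertices within each color of `T` are identified,
and two distinct resulting vertices are adjacent iff some representatives are
adjacent in `G`. -/
def Contract (G : SimpleGraph V) (T : Set (Set V)) :
    SimpleGraph (Quot (contractRel T)) :=
  SimpleGraph.fromRel (fun x y =>
    ∃ u v : V, Quot.mk (contractRel T) u = x ∧ Quot.mk (contractRel T) v = y ∧ G.Adj u v)

/-- `T` is a template in `G`: a finite collection of pairwise disjoint nonempty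
independent sets of vertices. -/
def IsTemplate (G : SimpleGraph V) (T : Set (Set V)) : Prop :=
  T.Finite ∧ (∀ C ∈ T, C.Nonempty) ∧ T.Pairwise (fun C D => Disjoint C D) ∧
    ∀ C ∈ T, Indep G C

/-- A coloring contains the template `T` if each color of `T` is monochromatic. -/
def ContainsTemplate {k : ℕ} (c : V → Fin k) (T : Set (Set V)) : Prop :=
  ∀ C ∈ T, Mono c C

/-- The coloring obtained from `c` by exchanging `α` and `β` on `K`. -/
noncomputable def swapOn {k : ℕ} (c : V → Fin k) (α β : Fin k) (K : Set V) :
    V → Fin k :=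
  open Classical in fun v => if v ∈ K then Equiv.swap α β (c v) else c v

/-- `K` is a union of connected components of `kempeGraph G c α β`. -/
def KempeClosed (G : SimpleGraph V) {k : ℕ} (c : V → Fin k) (α β : Fin k)
    (K : Set V) : Prop :=
  ∀ u ∈ K, ∀ w, G.Adj u w → (c u = α ∨ c u = β) → (c w = α ∨ c w = β) → w ∈ K

section

variable {G : SimpleGraph V} {k : ℕ} {c : V → Fin k} {α β : Fin k} {K : Set V}

theorem swapOn_of_mem {v : V} (hv : v ∈ K) : swapOn c α β K v = Equiv.swap α β (c v) := by
  simp [swapOn, hv]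

theorem swapOn_of_notMem {v : V} (hv : v ∉ K) : swapOn c α β K v = c v := by
  simp [swapOn, hv]

theorem swap_eq_or_iff (x : Fin k) :
    (Equiv.swap α β x = α ∨ Equiv.swap α β x = β) ↔ (x = α ∨ x = β) := by
  rw [Equiv.swap_apply_def]
  split_ifs <;> simp_all

theorem swapOn_eq_or_iff (v : V) :
    (swapOn c α β K v = α ∨ swapOn c α β K v = β) ↔ (c v = α ∨ c v = β) := by
  by_cases hv : v ∈ K
  · rw [swapOn_of_mem hv, swap_eq_or_iff]
  · rw [swapOn_of_notMem hv]

theorem swap_ne_of_not_both {x y : Fin k} (hxy : x ≠ y)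
    (h : ¬ ((x = α ∨ x = β) ∧ (y = α ∨ y = β))) : Equiv.swap α β x ≠ y := by
  rw [Equiv.swap_apply_def]
  split_ifs <;> grind

theorem Proper.swapOn (hc : Proper G c) (hK : KempeClosed G c α β K) :
    Proper G (swapOn c α β K) := by
  intro u v huv
  have hne := hc huv
  by_cases hu : u ∈ K <;> by_cases hv : v ∈ K
  · rw [swapOn_of_mem hu, swapOn_of_mem hv]
    exact (Equiv.swap α β).injective.ne hne
  · rw [swapOn_of_mem hu, swapOn_of_notMem hv]
    exact swap_ne_of_not_both hne fun h => hv (hK u hu v huv h.1 h.2)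
  · rw [swapOn_of_notMem hu, swapOn_of_mem hv]
    exact (swap_ne_of_not_both hne.symm fun h => hu (hK v hv u huv.symm h.1 h.2)).symm
  · rwa [swapOn_of_notMem hu, swapOn_of_notMem hv]

theorem kempeGraph_adj {u v : V} : (kempeGraph G c α β).Adj u v ↔
    G.Adj u v ∧ (c u = α ∨ c u = β) ∧ (c v = α ∨ c v = β) := by
  have : G.Adj u v → u ≠ v := SimpleGraph.Adj.ne
  have := G.adj_comm u v
  rw [kempeGraph, SimpleGraph.fromRel_adj]
  tauto

theorem kempeClosed_reachable (w : V) :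
    KempeClosed G c α β {v | (kempeGraph G c α β).Reachable w v} := by
  intro u hu v huv h₁ h₂
  exact hu.trans (SimpleGraph.Adj.reachable (kempeGraph_adj.2 ⟨huv, h₁, h₂⟩))

theorem KempeClosed.mem_of_reachable (hK : KempeClosed G c α β K) {u v : V} (hu : u ∈ K)
    (h : (kempeGraph G c α β).Reachable u v) : v ∈ K := by
  obtain ⟨p⟩ := h
  induction p with
  | nil => exact hu
  | cons h _ ih =>
    obtain ⟨h₀, h₁, h₂⟩ := kempeGraph_adj.1 h
    exact ih (hK _ hu _ h₀ h₁ h₂)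

theorem kempeStep_iff {c' : V → Fin k} : KempeStep G c c' ↔
    ∃ α β w, c' = swapOn c α β {v | (kempeGraph G c α β).Reachable w v} := by
  constructor
  · rintro ⟨α, β, w, h₁, h₂⟩
    refine ⟨α, β, w, funext fun v => ?_⟩
    by_cases hv : (kempeGraph G c α β).Reachable w v
    · rw [h₁ v hv, swapOn_of_mem (by exact hv)]
    · rw [h₂ v hv, swapOn_of_notMem (by exact hv)]
  · rintro ⟨α, β, w, rfl⟩
    exact ⟨α, β, w, fun v hv => swapOn_of_mem hv, fun v hv => swapOn_of_notMem hv⟩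

/-- Swapping two colors on a union of Kempe components is a sequence of Kempe swaps. -/
theorem KempeClosed.kempeEquiv_swapOn [Finite V] (hK : KempeClosed G c α β K) :
    KempeEquiv G c (KempePaper.swapOn c α β K) := by
  induction hn : K.ncard using Nat.strong_induction_on generalizing c K with
  | _ n ih =>
    obtain rfl | ⟨w, hw⟩ := K.eq_empty_or_nonempty
    · rw [show KempePaper.swapOn c α β ∅ = c from funext fun v => swapOn_of_notMem (by simp)]
      exact Relation.ReflTransGen.refl
    · set C : Set V := {v | (kempeGraph G c α β).Reachable w v} with hC
      have hwC : w ∈ C := SimpleGraph.Reachable.refl w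
      have hCK : C ⊆ K := fun v hv => hK.mem_of_reachable hw hv
      have hclosed : KempeClosed G (KempePaper.swapOn c α β C) α β (K \ C) := by
        intro u hu v huv h₁ h₂
        rw [swapOn_eq_or_iff] at h₁ h₂
        exact ⟨hK u hu.1 v huv h₁ h₂, fun hv =>
          hu.2 (kempeClosed_reachable w v hv u huv.symm h₂ h₁)⟩
      have hcard : (K \ C).ncard < n := by
        rw [← hn]
        exact Set.ncard_lt_ncard ⟨Set.sdiff_subset, fun h => (h hw).2 hwC⟩
      have heq : KempePaper.swapOn (KempePaper.swapOn c α β C) α β (K \ C) =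
          KempePaper.swapOn c α β K := by
        funext v
        by_cases hv : v ∈ C
        · rw [swapOn_of_notMem (fun h => h.2 hv), swapOn_of_mem hv, swapOn_of_mem (hCK hv)]
        · by_cases hvK : v ∈ K
          · rw [swapOn_of_mem (Set.mem_sdiff_of_mem hvK hv), swapOn_of_notMem hv, swapOn_of_mem hvK]
          · rw [swapOn_of_notMem (fun h => hvK h.1), swapOn_of_notMem hv, swapOn_of_notMem hvK]
      rw [← heq]
      exact (ih _ hcard hclosed rfl).head (kempeStep_iff.2 ⟨α, β, w, rfl⟩)

/-- Recoloring a vertex with a color absent from its neighborhood. -/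
theorem Proper.kempeEquiv_recolor [Finite V] {c' : V → Fin k} (hc : Proper G c)
    (hc' : Proper G c') {v : V} (h : ∀ u, u ≠ v → c u = c' u) : KempeEquiv G c c' := by
  have hcl : KempeClosed G c (c v) (c' v) {v} := by
    rintro u rfl w huw - hw
    refine absurd hw (not_or.2 ⟨(hc huw).symm, ?_⟩)
    rw [h w huw.ne']
    exact (hc' huw).symm
  convert hcl.kempeEquiv_swapOn using 1
  funext u
  by_cases hu : u = v
  · subst hu
    rw [swapOn_of_mem (Set.mem_singleton u), Equiv.swap_apply_left]
  · rw [swapOn_of_notMem (Set.mem_singleton_iff.not.2 hu), h u hu]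

/-- Kempe swaps lift along graph homomorphisms. -/
theorem KempeEquiv.comp [Finite V] {W : Type*} {H : SimpleGraph W} {f : V → W}
    (hf : ∀ u v, G.Adj u v → H.Adj (f u) (f v)) {e e' : W → Fin k} (h : KempeEquiv H e e') :
    KempeEquiv G (e ∘ f) (e' ∘ f) := by
  induction h with
  | refl => exact Relation.ReflTransGen.refl
  | @tail a b _ hs ih =>
    obtain ⟨α, β, w, rfl⟩ := kempeStep_iff.1 hs
    exact ih.trans (KempeClosed.kempeEquiv_swapOn
      (K := f ⁻¹' {v | (kempeGraph H a α β).Reachable w v})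
      fun u hu v huv h₁ h₂ => kempeClosed_reachable w (f u) hu (f v) (hf u v huv) h₁ h₂)

/-- A swap avoiding `v` extends to a union of Kempe components of `G`, unless `v` has two
neighbors of the color it would be given. -/
theorem exists_kempeClosed_of_forall_unique {v : V}
    (hK : ∀ u ∈ K, u ≠ v → ∀ w, w ≠ v → G.Adj u w → (c u = α ∨ c u = β) →
      (c w = α ∨ c w = β) → w ∈ K)
    (hv : (c v = α ∨ c v = β) → ∀ x y, G.Adj v x → G.Adj v y → (c x = α ∨ c x = β) →
      (c y = α ∨ c y = β) → x = y) :
    ∃ K', KempeClosed G c α β K' ∧ ∀ u, u ≠ v → (u ∈ K' ↔ u ∈ K) := by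
  by_cases hx : (c v = α ∨ c v = β) ∧ ∃ x ∈ K, G.Adj v x ∧ (c x = α ∨ c x = β)
  · obtain ⟨hcv, x, hxK, hvx, hcx⟩ := hx
    refine ⟨insert v K, ?_, fun u hu => by simp [hu]⟩
    intro u hu w huw h₁ h₂
    by_cases hwv : w = v
    · exact Or.inl hwv
    refine Or.inr ?_
    by_cases huv : u = v
    · subst huv
      rwa [hv hcv w x huw hvx h₂ hcx]
    · exact hK u (hu.resolve_left huv) huv w hwv huw h₁ h₂
  · refine ⟨K \ {v}, ?_, fun u hu => by simp [hu]⟩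
    intro u hu w huw h₁ h₂
    by_cases hwv : w = v
    · subst hwv
      exact absurd ⟨h₂, u, hu.1, huw.symm, h₁⟩ hx
    · exact ⟨hK u hu.1 hu.2 w hwv huw h₁ h₂, hwv⟩

/-- If two neighbors of a vertex `v` of degree less than `k` share a color, then `v` can be
recolored. -/
theorem Proper.exists_recolor [Finite V] (hc : Proper G c) {v x y : V}
    (hdeg : (G.neighborSet v).ncard < k) (hx : G.Adj v x) (hy : G.Adj v y) (hxy : x ≠ y)
    (hcxy : c x = c y) :
    ∃ c', Proper G c' ∧ (∀ u, u ≠ v → c u = c' u) ∧ c' v ≠ c v := by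
  classical
  obtain ⟨γ, hγ⟩ : ∃ γ, γ ∉ insert (c v) (c '' (G.neighborSet v \ {x})) := by
    by_contra! hall
    have h₁ : (insert (c v) (c '' (G.neighborSet v \ {x}))).ncard = k := by
      rw [Set.eq_univ_of_forall hall, Set.ncard_univ, Nat.card_fin]
    have h₂ := Set.ncard_insert_le (c v) (c '' (G.neighborSet v \ {x}))
    have h₃ := Set.ncard_image_le (f := c) (Set.toFinite (G.neighborSet v \ {x}))
    have h₄ := Set.ncard_sdiff_singleton_add_one (show x ∈ G.neighborSet v from hx)
    omega
  have hγv : γ ≠ c v := fun h => hγ (Or.inl h)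
  have hγN : ∀ u, G.Adj v u → c u ≠ γ := by
    intro u hu h
    by_cases hux : u = x
    · exact hγ (Or.inr ⟨y, ⟨hy, hxy.symm⟩, by rw [← hcxy, ← hux, h]⟩)
    · exact hγ (Or.inr ⟨u, ⟨hu, hux⟩, h⟩)
  refine ⟨Function.update c v γ, ?_, fun u hu => by simp [hu], by simpa⟩
  intro a b hab
  by_cases ha : a = v
  · subst ha
    simpa [hab.ne'] using (hγN b hab).symm
  · by_cases hb : b = v
    · subst hb
      simpa [ha] using hγN a hab.symm
    · simpa [ha, hb] using hc hab

/-- Kempe swaps after deletion of the edges at a vertex of degree less than `k` can be realized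
in the whole graph. -/
theorem KempeEquiv.exists_lift [Finite V] {H : SimpleGraph V} {v : V}
    (hH : ∀ x y, x ≠ v → y ≠ v → G.Adj x y → H.Adj x y)
    (hdeg : (G.neighborSet v).ncard < k) (hc : Proper G c) {e : V → Fin k}
    (h : KempeEquiv H c e) :
    ∃ c', Proper G c' ∧ KempeEquiv G c c' ∧ ∀ u, u ≠ v → c' u = e u := by
  induction h with
  | refl => exact ⟨c, hc, Relation.ReflTransGen.refl, fun _ _ => rfl⟩
  | @tail a b _ hs ih =>
    obtain ⟨α, β, w, rfl⟩ := kempeStep_iff.1 hs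
    obtain ⟨c₁, hp, he, ha⟩ := ih
    obtain ⟨c₂, hp₂, he₂, ha₂, huniq⟩ : ∃ c₂, Proper G c₂ ∧ KempeEquiv G c c₂ ∧
        (∀ u, u ≠ v → c₂ u = a u) ∧
        ((c₂ v = α ∨ c₂ v = β) → ∀ x y, G.Adj v x → G.Adj v y → (c₂ x = α ∨ c₂ x = β) →
          (c₂ y = α ∨ c₂ y = β) → x = y) := by
      by_cases hu : (c₁ v = α ∨ c₁ v = β) → ∀ x y, G.Adj v x → G.Adj v y →
          (c₁ x = α ∨ c₁ x = β) → (c₁ y = α ∨ c₁ y = β) → x = y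
      · exact ⟨c₁, hp, he, ha, hu⟩
      push Not at hu
      obtain ⟨hv, x, y, hx, hy, hcx, hcy, hxy⟩ := hu
      have hvx := hp hx
      have hvy := hp hy
      obtain ⟨c₂, hp₂, ha₂, hne⟩ := hp.exists_recolor hdeg hx hy hxy (by grind)
      refine ⟨c₂, hp₂, he.trans (hp.kempeEquiv_recolor hp₂ ha₂),
        fun u hu => (ha₂ u hu).symm.trans (ha u hu), fun hv₂ => ?_⟩
      have hvx₂ := hp₂ hx
      rw [← ha₂ x hx.ne'] at hvx₂
      grind
    obtain ⟨K, hK, hKv⟩ := exists_kempeClosed_of_forall_unique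
      (K := {u | (kempeGraph H a α β).Reachable w u}) (fun u hu huv z hzv huz h₁ h₂ => by
        rw [ha₂ _ huv] at h₁
        rw [ha₂ _ hzv] at h₂
        exact kempeClosed_reachable w u hu z (hH u z huv hzv huz) h₁ h₂) huniq
    refine ⟨_, hp₂.swapOn hK, he₂.trans hK.kempeEquiv_swapOn, fun u hu => ?_⟩
    by_cases huK : u ∈ K
    · rw [swapOn_of_mem huK, swapOn_of_mem ((hKv u hu).1 huK), ha₂ u hu]
    · rw [swapOn_of_notMem huK, swapOn_of_notMem (mt (hKv u hu).2 huK), ha₂ u hu]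

/-- Las Vergnas and Meyniel: all proper `k`-colorings of a finite `d`-degenerate graph with
`d < k` are Kempe equivalent. -/
theorem Degenerate.kempeEquiv [Finite V] {d : ℕ} (hG : Degenerate G d) (hdk : d < k)
    {c' : V → Fin k} (hc : Proper G c) (hc' : Proper G c') : KempeEquiv G c c' := by
  suffices h : ∀ S : Set V, ∃ e, KempeEquiv (G.induce S).spanningCoe c e ∧ ∀ v ∈ S, e v = c' v by
    obtain ⟨e, he, hee⟩ := h Set.univ
    obtain rfl : e = c' := funext fun v => hee v trivial
    refine KempeEquiv.comp (f := id) (fun u v huv => ?_) he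
    simpa using huv
  intro S
  induction hn : S.ncard generalizing S with
  | zero =>
    rw [Set.ncard_eq_zero] at hn
    exact ⟨c, Relation.ReflTransGen.refl, by simp [hn]⟩
  | succ n ih =>
    obtain ⟨v, hvS, hv⟩ := hG S S.toFinite ((Set.ncard_pos).1 (by omega))
    obtain ⟨e, he, hee⟩ := ih (S \ {v}) (by rw [Set.ncard_sdiff_singleton_of_mem hvS]; omega)
    have hproper : ∀ f : V → Fin k, Proper G f → Proper (G.induce S).spanningCoe f :=
      fun f hf x y hxy => hf (SimpleGraph.spanningCoe_induce_le G S hxy)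
    have hdeg : ((G.induce S).spanningCoe.neighborSet v).ncard < k := by
      refine (Set.ncard_le_ncard (fun x hx => ?_)).trans_lt (hv.trans_lt hdk)
      simp at hx
      exact ⟨hx.2.2, hx.1⟩
    obtain ⟨f, hf, hcf, hfe⟩ := he.exists_lift (G := (G.induce S).spanningCoe) (v := v)
      (fun x y hx hy hxy => by simp at hxy ⊢; tauto) hdeg (hproper c hc)
    classical
    refine ⟨Function.update f v (c' v), hcf.trans (hf.kempeEquiv_recolor ?_ (v := v) ?_), ?_⟩
    · intro x y hxy
      have hS : x ∈ S ∧ y ∈ S := by simp at hxy; tauto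
      have hup : ∀ z ∈ S, Function.update f v (c' v) z = c' z := by
        intro z hz
        by_cases hzv : z = v
        · simp [hzv]
        · simp [hzv, hfe z hzv, hee z ⟨hz, hzv⟩]
      rw [hup x hS.1, hup y hS.2]
      exact hproper c' hc' hxy
    · intro u hu
      simp [hu]
    · intro z hz
      by_cases hzv : z = v
      · simp [hzv]
      · simp [hzv, hfe z hzv, hee z ⟨hz, hzv⟩]

end

/-- A proper coloring containing `T` descends to a proper coloring of the contraction. -/
theorem ContainsTemplate.exists_contract {G : SimpleGraph V} {T : Set (Set V)} {k : ℕ}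
    {c : V → Fin k} (hc : Proper G c) (hT : ContainsTemplate c T) :
    ∃ e, Proper (Contract G T) e ∧ e ∘ Quot.mk (contractRel T) = c := by
  refine ⟨Quot.lift c ?_, ?_, rfl⟩
  · rintro u v (rfl | ⟨C, hC, hu, hv⟩)
    · rfl
    · exact hT C hC u hu v hv
  · intro x y hxy
    rw [Contract, SimpleGraph.fromRel_adj] at hxy
    obtain ⟨-, ⟨u, v, rfl, rfl, h⟩ | ⟨u, v, rfl, rfl, h⟩⟩ := hxy
    · exact hc h
    · exact (hc h).symm

/-- If `T` is a good template in `G`, then any two proper 5-colorings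
of `G` containing `T` are Kempe 5-equivalent. -/
theorem statement_3 {V : Type*} [Fintype V] (G : SimpleGraph V) (T : Set (Set V))
    (hT : IsTemplate G T) (hgood : Degenerate (Contract G T) 4)
    (c₁ c₂ : V → Fin 5) (h₁ : Proper G c₁) (h₂ : Proper G c₂)
    (hc₁ : ContainsTemplate c₁ T) (hc₂ : ContainsTemplate c₂ T) :
    KempeEquiv G c₁ c₂ := by
  obtain ⟨e₁, he₁, rfl⟩ := hc₁.exists_contract h₁
  obtain ⟨e₂, he₂, rfl⟩ := hc₂.exists_contract h₂
  refine (hgood.kempeEquiv (by norm_num) he₁ he₂).comp fun u v huv => ?_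
  rw [Contract, SimpleGraph.fromRel_adj]
  exact ⟨fun h => h₁ huv (congrArg e₁ h), Or.inl ⟨u, v, rfl, rfl, huv⟩⟩

end KempePaper
end

section
/- Let G be a finite simple graph that admits a proper 4-coloring. If φ1 and φ2 are proper 5-colorings of G that contain monochromatic good templates T1 and T2 respectively, then φ1 and φ2 are Kempe 5-equivalent. -/
namespace KempePaper

variable {V : Type*}

/-- `c` is a proper coloring of the subgraph of `G` induced by `S`. -/
def ProperOn (G : SimpleGraph V) (S : Set V) {k : ℕ} (c : V → Fin k) : Prop :=
  ∀ u ∈ S, ∀ v ∈ S, G.Adj u v → c u ≠ c v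

/-- `c₁` and `c₂` are proper on `S`, and on `S` they differ by interchanging two colors
on some set of vertices. -/
def SwapStep (G : SimpleGraph V) (S : Set V) {k : ℕ} (c₁ c₂ : V → Fin k) : Prop :=
  ProperOn G S c₁ ∧ ProperOn G S c₂ ∧
    ∃ α β : Fin k, ∀ v ∈ S, c₂ v = c₁ v ∨ c₂ v = Equiv.swap α β (c₁ v)

theorem SwapStep.symm {G : SimpleGraph V} {S : Set V} {k : ℕ} {c₁ c₂ : V → Fin k}
    (h : SwapStep G S c₁ c₂) : SwapStep G S c₂ c₁ := by
  obtain ⟨h₁, h₂, α, β, h⟩ := h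
  refine ⟨h₂, h₁, α, β, fun v hv => ?_⟩
  rcases h v hv with h | h
  · exact Or.inl h.symm
  · right
    rw [h, Equiv.swap_apply_self]

instance {G : SimpleGraph V} {S : Set V} {k : ℕ} :
    Std.Symm (SwapStep G S (k := k)) :=
  ⟨fun _ _ h => h.symm⟩

theorem swapStep_of_eqOn_compl_singleton {G : SimpleGraph V} {S : Set V} {k : ℕ}
    {c₁ c₂ : V → Fin k} (h₁ : ProperOn G S c₁) (h₂ : ProperOn G S c₂) (v : V)
    (h : ∀ u ∈ S, u ≠ v → c₂ u = c₁ u) : SwapStep G S c₁ c₂ := by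
  refine ⟨h₁, h₂, c₁ v, c₂ v, fun u hu => ?_⟩
  by_cases huv : u = v
  · subst huv
    right
    rw [Equiv.swap_apply_left]
  · exact Or.inl (h u hu huv)

theorem ProperOn.update {G : SimpleGraph V} {S : Set V} {k : ℕ} [DecidableEq V]
    {c : V → Fin k} {v : V} {γ : Fin k} (h : ProperOn G (S \ {v}) c)
    (hγ : ∀ u ∈ S, G.Adj v u → c u ≠ γ) : ProperOn G S (Function.update c v γ) := by
  intro x hx y hy hxy
  by_cases hxv : x = v <;> by_cases hyv : y = v
  · subst hxv hyv
    exact absurd hxy G.irrefl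
  · subst hxv
    simpa [hyv] using (hγ y hy hxy).symm
  · subst hyv
    simpa [hxv] using hγ x hx hxy.symm
  · simpa [hxv, hyv] using h x ⟨hx, hxv⟩ y ⟨hy, hyv⟩ hxy

/-- A swap step on `S \ {v}` lifts to `S` when `v` has fewer than `k` neighbors in `S`. -/
theorem exists_lift_swapStep {G : SimpleGraph V} {S : Set V} (hS : S.Finite) {k : ℕ}
    {a b a' : V → Fin k} {v : V} (hdeg : (S ∩ G.neighborSet v).ncard < k)
    (hab : SwapStep G (S \ {v}) a b) (ha' : ProperOn G S a')
    (haa' : ∀ u ∈ S \ {v}, a' u = a u) (hv : v ∈ S) :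
    ∃ b', ProperOn G S b' ∧ (∀ u ∈ S \ {v}, b' u = b u) ∧
      Relation.ReflTransGen (SwapStep G S) a' b' := by
  classical
  obtain ⟨ha, hb, α, β, h⟩ := hab
  have hnbr : ∀ u ∈ S, G.Adj v u → u ∈ S \ {v} := fun u hu hvu => ⟨hu, hvu.ne'⟩
  have upd : ∀ γ, ∀ u ∈ S \ {v}, Function.update b v γ u = b u := fun γ u hu => by
    simp [show u ≠ v from hu.2]
  by_cases h₁ : ∀ u ∈ S, G.Adj v u → b u ≠ a' v
  · refine ⟨_, hb.update h₁, upd _, .single ⟨ha', hb.update h₁, α, β, fun u hu => ?_⟩⟩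
    by_cases huv : u = v
    · simp [huv]
    · simpa [huv, haa' u ⟨hu, huv⟩] using h u ⟨hu, huv⟩
  by_cases h₂ : ∀ u ∈ S, G.Adj v u → b u ≠ Equiv.swap α β (a' v)
  · refine ⟨_, hb.update h₂, upd _, .single ⟨ha', hb.update h₂, α, β, fun u hu => ?_⟩⟩
    by_cases huv : u = v
    · simp [huv]
    · simpa [huv, haa' u ⟨hu, huv⟩] using h u ⟨hu, huv⟩
  push Not at h₁ h₂
  obtain ⟨x, hx, hvx, hbx⟩ := h₁
  obtain ⟨y, hy, hvy, hby⟩ := h₂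
  -- `x` and `y` have the same color under `a`, so a color is free at `v`.
  have hax : a x ≠ a' v := by
    rw [← haa' x (hnbr x hx hvx)]
    exact ha' x hx v hv hvx.symm
  have hay : a y ≠ a' v := by
    rw [← haa' y (hnbr y hy hvy)]
    exact ha' y hy v hv hvy.symm
  have hx' : a x = Equiv.swap α β (a' v) := by
    rcases h x (hnbr x hx hvx) with e | e
    · exact absurd (e.symm.trans hbx) hax
    · rw [← hbx, e, Equiv.swap_apply_self]
  have hy' : a y = Equiv.swap α β (a' v) := by
    rcases h y (hnbr y hy hvy) with e | e
    · exact e.symm.trans hby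
    · exact absurd ((Equiv.swap α β).injective (e.symm.trans hby)) hay
  have hne : Equiv.swap α β (a' v) ≠ a' v := fun e => hax (hx'.trans e)
  have hxy : x ≠ y := by
    rintro rfl
    exact hne (hby.symm.trans hbx)
  obtain ⟨N, hN⟩ := (hS.inter_of_left (G.neighborSet v)).exists_finset_coe
  have hNmem : ∀ u, u ∈ N ↔ u ∈ S ∧ G.Adj v u := fun u => by
    rw [← Finset.mem_coe, hN]
    simp
  rw [← hN, Set.ncard_coe_finset] at hdeg
  have hcard : (insert (a' v) ((N.erase x).image a)).card < k := by
    have hxN : x ∈ N := (hNmem x).2 ⟨hx, hvx⟩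
    have e₁ := Finset.card_insert_le (a' v) ((N.erase x).image a)
    have e₂ : ((N.erase x).image a).card ≤ (N.erase x).card := Finset.card_image_le
    have e₃ := Finset.card_erase_add_one hxN
    omega
  obtain ⟨γ, hγ⟩ : ∃ γ, γ ∉ insert (a' v) ((N.erase x).image a) := by
    by_contra! hall
    have := Finset.card_le_card (fun γ _ => hall γ : Finset.univ ⊆ _)
    rw [Finset.card_fin] at this
    omega
  simp only [Finset.mem_insert, Finset.mem_image, Finset.mem_erase, not_or, not_exists,
    not_and] at hγ
  obtain ⟨hγv, hγN⟩ := hγ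
  have hγs : Equiv.swap α β (a' v) ≠ γ := by
    rw [← hy']
    exact hγN y ⟨hxy.symm, (hNmem y).2 ⟨hy, hvy⟩⟩
  have hγa : ∀ u ∈ S, G.Adj v u → a u ≠ γ := fun u hu hvu => by
    by_cases hux : u = x
    · rw [hux, hx']
      exact hγs
    · exact hγN u ⟨hux, (hNmem u).2 ⟨hu, hvu⟩⟩
  have hswap : Equiv.swap α β γ = γ := by
    have := Equiv.swap_apply_ne_self_iff.1 hne
    grind
  have hγb : ∀ u ∈ S, G.Adj v u → b u ≠ γ := fun u hu hvu e => by
    rcases h u (hnbr u hu hvu) with e' | e'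
    · exact hγa u hu hvu (e'.symm.trans e)
    · refine hγa u hu hvu ((Equiv.swap α β).injective ?_)
      rw [← e', e, hswap]
  have ha'' : ProperOn G S (Function.update a v γ) := ha.update hγa
  refine ⟨_, hb.update hγb, upd _, .head (b := Function.update a v γ) ?_ (.single ?_)⟩
  · refine swapStep_of_eqOn_compl_singleton ha' ha'' v fun u hu huv => ?_
    simp [huv, haa' u ⟨hu, huv⟩]
  · refine ⟨ha'', hb.update hγb, α, β, fun u hu => ?_⟩
    by_cases huv : u = v
    · simp [huv]
    · simpa [huv] using h u ⟨hu, huv⟩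

/-- Las Vergnas–Meyniel: on a `d`-degenerate graph, any two proper colorings with more than
`d` colors are connected by swap steps. -/
theorem Degenerate.reflTransGen_swapStep {G : SimpleGraph V} {d k : ℕ} (hG : Degenerate G d)
    (hk : d < k) (n : ℕ) : ∀ {S : Set V}, S.Finite → S.ncard = n →
    ∀ {c₁ c₂ : V → Fin k}, ProperOn G S c₁ → ProperOn G S c₂ →
      Relation.ReflTransGen (SwapStep G S) c₁ c₂ := by
  induction n with
  | zero =>
    intro S hS hn c₁ c₂ h₁ h₂
    rw [Set.ncard_eq_zero hS] at hn
    subst hn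
    exact .single ⟨h₁, h₂, ⟨d, hk⟩, ⟨d, hk⟩, by simp⟩
  | succ n ih =>
    intro S hS hn c₁ c₂ h₁ h₂
    have hne : S.Nonempty := by
      rw [← Set.ncard_pos hS]
      omega
    obtain ⟨v, hv, hdeg⟩ := hG S hS hne
    have hn' : (S \ {v}).ncard = n := by
      rw [Set.ncard_sdiff_singleton_of_mem hv]
      omega
    have hsteps := ih hS.sdiff hn'
      (fun x hx y hy => h₁ x hx.1 y hy.1) (fun x hx y hy => h₂ x hx.1 y hy.1)
    have lift : ∃ b', ProperOn G S b' ∧ (∀ u ∈ S \ {v}, b' u = c₂ u) ∧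
        Relation.ReflTransGen (SwapStep G S) c₁ b' := by
      clear h₂
      induction hsteps with
      | refl => exact ⟨c₁, h₁, fun _ _ => rfl, .refl⟩
      | tail _ hstep ih' =>
        obtain ⟨a', ha', heq, hr⟩ := ih'
        obtain ⟨b', hb', heq', hr'⟩ :=
          exists_lift_swapStep hS (hdeg.trans_lt hk) hstep ha' heq hv
        exact ⟨b', hb', heq', hr.trans hr'⟩
    obtain ⟨b', hb', heq, hr⟩ := lift
    exact hr.tail (swapStep_of_eqOn_compl_singleton hb' h₂ v
      fun u hu huv => (heq u ⟨hu, huv⟩).symm)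

/-- A Kempe swap preserves properness. -/
theorem Proper.of_kempe_swap {G : SimpleGraph V} {k : ℕ} {c c' : V → Fin k} (hc : Proper G c)
    {α β : Fin k} {w : V}
    (h₁ : ∀ v, (kempeGraph G c α β).Reachable w v → c' v = Equiv.swap α β (c v))
    (h₂ : ∀ v, ¬ (kempeGraph G c α β).Reachable w v → c' v = c v) : Proper G c' := by
  have key : ∀ u v, G.Adj u v → (kempeGraph G c α β).Reachable w u →
      ¬ (kempeGraph G c α β).Reachable w v → Equiv.swap α β (c u) ≠ c v := by
    intro u v huv hu hv
    have hnot : ¬ ((c u = α ∨ c u = β) ∧ (c v = α ∨ c v = β)) := fun h =>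
      hv (hu.trans (SimpleGraph.Adj.reachable
        ((SimpleGraph.fromRel_adj _ _ _).2 ⟨huv.ne, Or.inl ⟨huv, h⟩⟩)))
    have := hc huv
    grind
  intro u v huv
  by_cases hu : (kempeGraph G c α β).Reachable w u <;>
    by_cases hv : (kempeGraph G c α β).Reachable w v
  · rw [h₁ u hu, h₁ v hv]
    exact fun e => hc huv ((Equiv.swap α β).injective e)
  · rw [h₁ u hu, h₂ v hv]
    exact key u v huv hu hv
  · rw [h₂ u hu, h₁ v hv]
    exact (key v u huv.symm hv hu).symm
  · rw [h₂ u hu, h₂ v hv]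
    exact hc huv

/-- A swap step decomposes into Kempe swaps. -/
theorem kempeEquiv_of_swap [Finite V] {G : SimpleGraph V} {k : ℕ} {c₂ : V → Fin k}
    (h₂ : Proper G c₂) (α β : Fin k) (n : ℕ) : ∀ {c₁ : V → Fin k}, {v | c₂ v ≠ c₁ v}.ncard ≤ n →
    Proper G c₁ → (∀ v, c₂ v = c₁ v ∨ c₂ v = Equiv.swap α β (c₁ v)) → KempeEquiv G c₁ c₂ := by
  classical
  induction n with
  | zero =>
    intro c₁ hn _ _
    have hempty : {v | c₂ v ≠ c₁ v} = ∅ := (Set.ncard_eq_zero (Set.toFinite _)).1 (by omega)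
    have : c₁ = c₂ := by
      funext v
      by_contra hv
      exact (Set.eq_empty_iff_forall_notMem.1 hempty v) (Ne.symm hv)
    subst this
    exact .refl
  | succ n ih =>
    intro c₁ hn h₁ h
    by_cases hw : ∃ w, c₂ w ≠ c₁ w
    · obtain ⟨w, hw⟩ := hw
      have hreach : ∀ v, (kempeGraph G c₁ α β).Reachable w v → c₂ v ≠ c₁ v := by
        intro v hv
        rw [SimpleGraph.reachable_iff_reflTransGen] at hv
        induction hv with
        | refl => exact hw
        | @tail x y _ hxy ihx =>
          obtain ⟨-, hxy⟩ := (SimpleGraph.fromRel_adj _ _ _).1 hxy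
          have hadj : G.Adj x y := by
            rcases hxy with h | h
            · exact h.1
            · exact h.1.symm
          have := h₁ hadj
          have := h₂ hadj
          have := h x
          have := h y
          grind
      let c' : V → Fin k := fun v =>
        if (kempeGraph G c₁ α β).Reachable w v then Equiv.swap α β (c₁ v) else c₁ v
      have e₁ : ∀ v, (kempeGraph G c₁ α β).Reachable w v → c' v = Equiv.swap α β (c₁ v) :=
        fun v hv => if_pos hv
      have e₂ : ∀ v, ¬ (kempeGraph G c₁ α β).Reachable w v → c' v = c₁ v :=
        fun v hv => if_neg hv
      have e₃ : ∀ v, (kempeGraph G c₁ α β).Reachable w v → c₂ v = c' v := fun v hv =>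
        ((h v).resolve_left (hreach v hv)).trans (e₁ v hv).symm
      refine .head ⟨α, β, w, e₁, e₂⟩ (ih ?_ (h₁.of_kempe_swap e₁ e₂) fun v => ?_)
      · refine Nat.le_of_lt_succ (lt_of_lt_of_le (Set.ncard_lt_ncard ?_ (Set.toFinite _)) hn)
        refine ⟨fun v hv => ?_, fun hsub => hsub hw (e₃ w (.refl w))⟩
        have hv' : ¬ (kempeGraph G c₁ α β).Reachable w v := fun hr => hv (e₃ v hr)
        simpa [e₂ v hv'] using hv
      · by_cases hv : (kempeGraph G c₁ α β).Reachable w v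
        · exact Or.inl (e₃ v hv)
        · rw [e₂ v hv]
          exact h v
    · push Not at hw
      rw [← funext hw]
      exact .refl

theorem SwapStep.kempeEquiv [Finite V] {G : SimpleGraph V} {k : ℕ} {c₁ c₂ : V → Fin k}
    (h : SwapStep G Set.univ c₁ c₂) : KempeEquiv G c₁ c₂ := by
  obtain ⟨h₁, h₂, α, β, h⟩ := h
  exact kempeEquiv_of_swap (fun u v => h₂ u trivial v trivial) α β _ le_rfl
    (fun u v => h₁ u trivial v trivial) fun v => h v trivial

theorem kempeEquiv_of_reflTransGen [Finite V] {G : SimpleGraph V} {k : ℕ} {c₁ c₂ : V → Fin k}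
    (h : Relation.ReflTransGen (SwapStep G Set.univ) c₁ c₂) : KempeEquiv G c₁ c₂ := by
  induction h with
  | refl => exact .refl
  | tail _ hs ih => exact Relation.ReflTransGen.trans ih hs.kempeEquiv

theorem ContainsTemplate.eq_of_contractRel {T : Set (Set V)} {k : ℕ} {c : V → Fin k}
    (h : ContainsTemplate c T) {u v : V} (huv : contractRel T u v) : c u = c v := by
  rcases huv with rfl | ⟨C, hC, hu, hv⟩
  · rfl
  · exact h C hC u hu v hv

/-- Proper colorings containing a common good template are connected by swap steps. -/
theorem reflTransGen_swapStep_of_containsTemplate [Finite V] {G : SimpleGraph V}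
    {T : Set (Set V)} {d k : ℕ} (hgood : Degenerate (Contract G T) d) (hk : d < k)
    {c₁ c₂ : V → Fin k} (h₁ : Proper G c₁) (h₂ : Proper G c₂) (hc₁ : ContainsTemplate c₁ T)
    (hc₂ : ContainsTemplate c₂ T) :
    Relation.ReflTransGen (SwapStep G Set.univ) c₁ c₂ := by
  have proper_lift : ∀ {c : V → Fin k}, Proper G c → ∀ hc : ContainsTemplate c T,
      ProperOn (Contract G T) Set.univ (Quot.lift c fun _ _ => hc.eq_of_contractRel) := by
    rintro c h hc x - y - hxy
    obtain ⟨-, ⟨u, v, rfl, rfl, huv⟩ | ⟨u, v, rfl, rfl, huv⟩⟩ :=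
      (SimpleGraph.fromRel_adj _ _ _).1 hxy
    · exact h huv
    · exact (h huv).symm
  have proper_comp : ∀ {c : Quot (contractRel T) → Fin k},
      ProperOn (Contract G T) Set.univ c → ProperOn G Set.univ (c ∘ Quot.mk _) := by
    intro c h u _ v _ huv
    refine h _ trivial _ trivial ((SimpleGraph.fromRel_adj _ _ _).2 ⟨fun e => ?_,
      Or.inl ⟨u, v, rfl, rfl, huv⟩⟩)
    exact h₁ huv (congrArg (Quot.lift c₁ fun _ _ => hc₁.eq_of_contractRel) e)
  exact (hgood.reflTransGen_swapStep hk _ Set.finite_univ rfl (proper_lift h₁ hc₁)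
    (proper_lift h₂ hc₂)).lift (· ∘ Quot.mk _) fun _ _ ⟨ha, hb, α, β, h⟩ =>
      ⟨proper_comp ha, proper_comp hb, α, β, fun v _ => h _ trivial⟩

/-- A coloring avoiding the last color is connected by swap steps to the coloring obtained by
giving the last color to all vertices of an independent set. -/
theorem reflTransGen_swapStep_recolor {G : SimpleGraph V} {k : ℕ} {c : V → Fin k}
    (hc : Proper G c) {C : Set V} [DecidablePred (· ∈ C)] (hC : Indep G C) :
    Proper G (fun v => if v ∈ C then Fin.last k else (c v).castSucc) ∧
    Relation.ReflTransGen (SwapStep G Set.univ) (fun v => (c v).castSucc)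
      (fun v => if v ∈ C then Fin.last k else (c v).castSucc) := by
  let f : ℕ → V → Fin (k + 1) := fun j v =>
    if v ∈ C ∧ (c v : ℕ) < j then Fin.last k else (c v).castSucc
  have hf : ∀ j, Proper G (f j) := by
    intro j u v huv
    have h₁ := hc huv
    have h₂ : ¬ (u ∈ C ∧ v ∈ C) := fun h => hC u h.1 v h.2 huv
    have h₃ := (c u).castSucc_lt_last.ne
    have h₄ := (c v).castSucc_lt_last.ne
    have h₅ : (c u).castSucc ≠ (c v).castSucc := fun e => h₁ (Fin.castSucc_injective _ e)
    simp only [f]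
    grind
  have h₀ : f 0 = fun v => (c v).castSucc := by
    funext v
    simp [f]
  have hk : f k = fun v => if v ∈ C then Fin.last k else (c v).castSucc := by
    funext v
    simp [f]
  have hsteps : ∀ j ≤ k, Relation.ReflTransGen (SwapStep G Set.univ) (f 0) (f j) := by
    intro j
    induction j with
    | zero => exact fun _ => .refl
    | succ j ih =>
      intro hj
      refine (ih (by omega)).tail ⟨fun u _ v _ h => hf _ h, fun u _ v _ h => hf _ h,
        Fin.castSucc ⟨j, hj⟩, Fin.last k, fun v _ => ?_⟩
      by_cases hv : v ∈ C
      · rcases lt_trichotomy (c v : ℕ) j with h | h | h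
        · simp [f, h, Nat.lt_succ_of_lt h]
        · right
          have : c v = ⟨j, hj⟩ := Fin.ext h
          simp [f, hv, this]
        · left
          simp [f, h.not_gt, show ¬ (c v : ℕ) < j + 1 by omega]
      · simp [f, hv]
  rw [← h₀, ← hk]
  exact ⟨hf k, hsteps k le_rfl⟩

/-- If `G` admits a proper 4-coloring and `φ₁, φ₂` are proper
5-colorings containing monochromatic good templates `T₁, T₂` respectively, then
`φ₁` and `φ₂` are Kempe 5-equivalent. -/
theorem statement_4 {V : Type*} [Fintype V] (G : SimpleGraph V)
    (hcol : ∃ c : V → Fin 4, Proper G c)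
    (T₁ T₂ : Set (Set V))
    (hT₁ : IsTemplate G T₁) (hmono₁ : ∃ C, T₁ = {C})
    (hgood₁ : Degenerate (Contract G T₁) 4)
    (hT₂ : IsTemplate G T₂) (hmono₂ : ∃ C, T₂ = {C})
    (hgood₂ : Degenerate (Contract G T₂) 4)
    (φ₁ φ₂ : V → Fin 5) (h₁ : Proper G φ₁) (h₂ : Proper G φ₂)
    (hc₁ : ContainsTemplate φ₁ T₁) (hc₂ : ContainsTemplate φ₂ T₂) :
    KempeEquiv G φ₁ φ₂ := by
  classical
  obtain ⟨c, hc⟩ := hcol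
  have key : ∀ (T : Set (Set V)), IsTemplate G T → (∃ C, T = {C}) →
      Degenerate (Contract G T) 4 → ∀ φ : V → Fin 5, Proper G φ → ContainsTemplate φ T →
      Relation.ReflTransGen (SwapStep G Set.univ) φ (fun v => (c v).castSucc) := by
    rintro T hT ⟨C, rfl⟩ hgood φ hφ hφT
    obtain ⟨hψ, hsteps⟩ := reflTransGen_swapStep_recolor hc (hT.2.2.2 C rfl)
    refine (reflTransGen_swapStep_of_containsTemplate hgood (by norm_num) hφ hψ hφT ?_).trans
      (symm_of (Relation.ReflTransGen _) hsteps)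
    rintro D rfl u hu v hv
    simp [hu, hv]
  exact kempeEquiv_of_reflTransGen ((key T₁ hT₁ hmono₁ hgood₁ φ₁ h₁ hc₁).trans
    (symm_of (Relation.ReflTransGen _)
      (key T₂ hT₂ hmono₂ hgood₂ φ₂ h₂ hc₂)))

end KempePaper
end

section
/- For all integers a ≥ 7 and b ≥ 7, the set S = {(−1,0), (0,1), (1,−1), (1,2)} (with coordinates taken in (ZMod a) × (ZMod b)) is an independent set in the triangulated toroidal grid T[a×b], and the identification T[a×b]/S is 4-degenerate; that is, S is a good 4-template in T[a×b]. -/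
namespace KempePaper

variable {V : Type*}

/-- The six directions of the triangulated grid, as integer vectors. -/
def gridDirs : Finset (ℤ × ℤ) := {(0,1), (0,-1), (1,0), (-1,0), (1,-1), (-1,1)}

/-- The four vertices of the template, as integer points. -/
def templatePts : Finset (ℤ × ℤ) := {(-1,0), (0,1), (1,-1), (1,2)}

/-- The projection of the integer lattice onto the vertices of the toroidal grid. -/
def toTorus (a b : ℕ) : ℤ × ℤ →+ ZMod a × ZMod b :=
  (Int.castAddHom (ZMod a)).prodMap (Int.castAddHom (ZMod b))

theorem toTorus_surjective (a b : ℕ) : Function.Surjective (toTorus a b) :=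
  Function.Surjective.prodMap ZMod.intCast_surjective ZMod.intCast_surjective

theorem toTorus_apply (a b : ℕ) (x y : ℤ) : toTorus a b (x, y) = ((x : ZMod a), (y : ZMod b)) :=
  rfl

theorem toTorus_image_templatePts (a b : ℕ) :
    toTorus a b '' templatePts =
      ({(-1, 0), (0, 1), (1, -1), (1, 2)} : Set (ZMod a × ZMod b)) := by
  simp [templatePts, Set.image_insert_eq, toTorus_apply]

theorem intCast_zmod_eq_of_small {n : ℕ} (hn : 7 ≤ n) {x y : ℤ} (h : (x : ZMod n) = y)
    (hxy : (x - y).natAbs < 7) : x = y := by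
  have hd : (n : ℤ) ∣ x - y := by
    rw [← ZMod.intCast_eq_intCast_iff_dvd_sub, h]
  have := Int.eq_zero_of_dvd_of_natAbs_lt_natAbs hd (by simp; omega)
  omega

theorem toTorus_eq_of_small {a b : ℕ} (ha : 7 ≤ a) (hb : 7 ≤ b) {p q : ℤ × ℤ}
    (h : toTorus a b p = toTorus a b q)
    (hpq : (p.1 - q.1).natAbs < 7 ∧ (p.2 - q.2).natAbs < 7) : p = q :=
  Prod.ext (intCast_zmod_eq_of_small ha (congrArg Prod.fst h) hpq.1)
    (intCast_zmod_eq_of_small hb (congrArg Prod.snd h) hpq.2)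

theorem exists_gridDirs_of_adj {a b : ℕ} {u v : ZMod a × ZMod b} (h : (triGrid a b).Adj u v) :
    ∃ d ∈ gridDirs, v = u + toTorus a b d := by
  have key : ∀ w : ZMod a × ZMod b,
      w ∈ ({(0,1), (0,-1), (1,0), (-1,0), (1,-1), (-1,1)} : Set (ZMod a × ZMod b)) →
      ∃ d ∈ gridDirs, w = toTorus a b d := by
    intro w hw
    simpa [gridDirs, toTorus_apply] using hw
  obtain ⟨-, h | h⟩ := h
  · obtain ⟨d, hd, h⟩ := key _ h
    refine ⟨-d, (by decide : ∀ d ∈ gridDirs, -d ∈ gridDirs) d hd, ?_⟩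
    rw [map_neg, ← h]
    abel
  · obtain ⟨d, hd, h⟩ := key _ h
    exact ⟨d, hd, by rw [← h]; abel⟩

theorem mk_identifyRel_eq_iff {S : Set V} {u v : V} :
    Quot.mk (identifyRel S) u = Quot.mk (identifyRel S) v ↔ identifyRel S u v := by
  have he : Equivalence (identifyRel S) :=
    ⟨fun _ => Or.inl rfl, by unfold identifyRel; grind, by unfold identifyRel; grind⟩
  rw [Quot.eq, he.eqvGen_iff]

theorem exists_adj_of_identify_adj {G : SimpleGraph V} {S : Set V} {u : V}
    {y : Quot (identifyRel S)} (h : (Identify G S).Adj (Quot.mk _ u) y) :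
    ∃ u' v, identifyRel S u' u ∧ Quot.mk _ v = y ∧ G.Adj u' v := by
  obtain ⟨-, ⟨u', v, hu, hv, h⟩ | ⟨v, u', hv, hu, h⟩⟩ := h
  · exact ⟨u', v, mk_identifyRel_eq_iff.1 hu, hv, h⟩
  · exact ⟨u', v, mk_identifyRel_eq_iff.1 hu, hv, h.symm⟩

/-- A set of lattice points containing a small triangle and closed under adding every point
with two neighbors in the set is the whole lattice. -/
theorem forall_of_two_neighbors {P : ℤ × ℤ → Prop}
    (hP : ∀ p, ∀ d ∈ gridDirs, ∀ e ∈ gridDirs, d ≠ e → P (p + d) → P (p + e) → P p)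
    (h₀ : P (0, 0)) (h₁ : P (1, 0)) (p : ℤ × ℤ) : P p := by
  have next : ∀ x y d₁ d₂ e₁ e₂ : ℤ, (d₁, d₂) ∈ gridDirs → (e₁, e₂) ∈ gridDirs →
      (d₁, d₂) ≠ (e₁, e₂) → P (x + d₁, y + d₂) → P (x + e₁, y + e₂) → P (x, y) :=
    fun x y d₁ d₂ e₁ e₂ hd he hne h h' => hP (x, y) _ hd _ he hne h h'
  have up : ∀ x y, P (x, y) → P (x + 1, y) → P (x, y + 1) ∧ P (x + 1, y + 1) := by
    intro x y h h'
    have h2 : P (x, y + 1) := next x (y + 1) 0 (-1) 1 (-1) (by decide) (by decide) (by decide)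
      (by simpa using h) (by simpa using h')
    exact ⟨h2, next (x + 1) (y + 1) 0 (-1) (-1) 0 (by decide) (by decide) (by decide)
      (by simpa using h') (by simpa using h2)⟩
  have down : ∀ x y, P (x, y) → P (x + 1, y) → P (x, y - 1) ∧ P (x + 1, y - 1) := by
    intro x y h h'
    have h2 : P (x + 1, y - 1) := next (x + 1) (y - 1) 0 1 (-1) 1 (by decide) (by decide)
      (by decide) (by simpa using h') (by simpa using h)
    exact ⟨next x (y - 1) 0 1 1 0 (by decide) (by decide) (by decide)
      (by simpa using h) (by simpa using h2), h2⟩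
  have right : ∀ x y, P (x, y) → P (x + 1, y) → P (x + 1, y) ∧ P (x + 1 + 1, y) := by
    intro x y h h'
    have h2 := (down x y h h').2
    have h3 : P (x + 1 + 1, y - 1) := next (x + 1 + 1) (y - 1) (-1) 0 (-1) 1 (by decide)
      (by decide) (by decide) (by simpa using h2) (by simpa using h')
    exact ⟨h', next (x + 1 + 1) y (-1) 0 0 (-1) (by decide) (by decide) (by decide)
      (by simpa using h') (by simpa [sub_eq_add_neg] using h3)⟩
  have left : ∀ x y, P (x, y) → P (x + 1, y) → P (x - 1, y) ∧ P (x - 1 + 1, y) := by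
    intro x y h h'
    have h2 := (up x y h h').1
    have h3 : P (x - 1, y + 1) := next (x - 1) (y + 1) 1 0 1 (-1) (by decide)
      (by decide) (by decide) (by simpa using h2) (by simpa using h)
    exact ⟨next (x - 1) y 1 0 0 1 (by decide) (by decide) (by decide)
      (by simpa using h) (by simpa using h3), by simpa using h⟩
  have row : ∀ x : ℤ, P (x, 0) ∧ P (x + 1, 0) := by
    intro x
    induction x using Int.induction_on with
    | zero => exact ⟨h₀, by simpa using h₁⟩
    | succ i ih => exact right _ _ ih.1 ih.2
    | pred i ih => exact left _ _ ih.1 ih.2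
  have all : ∀ x y : ℤ, P (x, y) ∧ P (x + 1, y) := by
    intro x y
    induction y using Int.induction_on with
    | zero => exact row x
    | succ i ih => exact up _ _ ih.1 ih.2
    | pred i ih => exact down _ _ ih.1 ih.2
  exact (all p.1 p.2).1

open Classical in
/-- Deleting vertices of degree at most four one after another, starting near the template,
exhausts the identification. -/
theorem degenerate_identify_template {a b : ℕ} (ha : 7 ≤ a) (hb : 7 ≤ b) :
    Degenerate (Identify (triGrid a b) (toTorus a b '' templatePts)) 4 := by
  set S : Set (ZMod a × ZMod b) := toTorus a b '' templatePts
  intro K _ hne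
  by_contra! hK
  let π : ℤ × ℤ → Quot (identifyRel S) := fun p => Quot.mk _ (toTorus a b p)
  have π_surj : Function.Surjective π := Quot.mk_surjective.comp (toTorus_surjective a b)
  have π_template : ∀ p ∈ templatePts, π p = π (0, 1) := fun p hp =>
    Quot.sound (Or.inr ⟨⟨p, hp, rfl⟩, ⟨(0, 1), by decide, rfl⟩⟩)
  have notMem_of_cover : ∀ p (T : Finset (ℤ × ℤ)), T.card ≤ 4 →
      (∀ y ∈ K, (Identify (triGrid a b) S).Adj (π p) y → ∃ q ∈ T, π q = y) → π p ∉ K := by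
    intro p T hT h hp
    refine absurd (hK _ hp) (not_lt.2 ?_)
    calc _ ≤ (↑(T.image π) : Set (Quot (identifyRel S))).ncard :=
          Set.ncard_le_ncard (fun y hy => by simpa using h y hy.1 hy.2) (Finset.finite_toSet _)
      _ ≤ 4 := by
          rw [Set.ncard_coe_finset]
          exact Finset.card_image_le.trans hT
  have notMem_of_dirs : ∀ p, toTorus a b p ∉ S → ∀ E : Finset (ℤ × ℤ), E.card ≤ 4 →
      (∀ d ∈ gridDirs, π (p + d) ∉ K ∨ ∃ q ∈ E, π q = π (p + d)) → π p ∉ K := by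
    intro p hpS E hE h
    refine notMem_of_cover p E hE fun y hy hadj => ?_
    obtain ⟨u, v, hu, rfl, huv⟩ := exists_adj_of_identify_adj hadj
    obtain rfl : u = toTorus a b p := hu.resolve_right fun h => hpS h.2
    obtain ⟨d, hd, rfl⟩ := exists_gridDirs_of_adj huv
    rw [← map_add] at hy ⊢
    exact (h d hd).resolve_left (not_not.2 hy)
  have two_neighbors : ∀ p, toTorus a b p ∉ S → ∀ d ∈ gridDirs, ∀ e ∈ gridDirs, d ≠ e →
      π (p + d) ∉ K → π (p + e) ∉ K → π p ∉ K := by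
    intro p hpS d hd e he hde hpd hpe
    refine notMem_of_dirs p hpS (((gridDirs.erase d).erase e).image (p + ·)) ?_ ?_
    · refine Finset.card_image_le.trans ?_
      rw [Finset.card_erase_of_mem (Finset.mem_erase.2 ⟨hde.symm, he⟩),
        Finset.card_erase_of_mem hd]
      decide
    · intro f hf
      by_cases hfd : f = d
      · exact Or.inl (hfd ▸ hpd)
      by_cases hfe : f = e
      · exact Or.inl (hfe ▸ hpe)
      · exact Or.inr ⟨p + f, Finset.mem_image_of_mem _
          (Finset.mem_erase.2 ⟨hfe, Finset.mem_erase.2 ⟨hfd, hf⟩⟩), rfl⟩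
  have notMem_template : ∀ p : ℤ × ℤ, p ∉ templatePts →
      (∀ s ∈ templatePts, (s.1 - p.1).natAbs < 7 ∧ (s.2 - p.2).natAbs < 7) →
      toTorus a b p ∉ S := by
    rintro p hp hsmall ⟨s, hs, h⟩
    exact hp (toTorus_eq_of_small ha hb h (hsmall s hs) ▸ hs)
  -- Vertices with several neighbors in the template.
  have near_template : ∀ p (E : Finset (ℤ × ℤ)), p ∉ templatePts →
      (∀ s ∈ templatePts, (s.1 - p.1).natAbs < 7 ∧ (s.2 - p.2).natAbs < 7) →
      E.card ≤ 3 →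
      (∀ d ∈ gridDirs, p + d ∈ templatePts ∨ p + d ∈ E ∨ π (p + d) ∉ K) → π p ∉ K := by
    intro p E hp hsmall hE h
    refine notMem_of_dirs p (notMem_template p hp hsmall) (insert (0, 1) E)
      ((Finset.card_insert_le _ _).trans (by omega)) fun d hd => ?_
    rcases h d hd with h | h | h
    · exact Or.inr ⟨_, Finset.mem_insert_self _ _, (π_template _ h).symm⟩
    · exact Or.inr ⟨_, Finset.mem_insert_of_mem h, rfl⟩
    · exact Or.inl h
  have next : ∀ p q r : ℤ × ℤ, p ∉ templatePts →
      (∀ s ∈ templatePts, (s.1 - p.1).natAbs < 7 ∧ (s.2 - p.2).natAbs < 7) →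
      q - p ∈ gridDirs → r - p ∈ gridDirs → q ≠ r → π q ∉ K → π r ∉ K → π p ∉ K := by
    intro p q r hp hsmall hq hr hqr hqK hrK
    exact two_neighbors p (notMem_template p hp hsmall) _ hq _ hr (by simpa using hqr)
      (by simpa using hqK) (by simpa using hrK)
  have h00 : π (0, 0) ∉ K := near_template _ {(0,-1), (1,0), (-1,1)} (by decide) (by decide)
    (by decide) fun d hd => ((by decide : ∀ d ∈ gridDirs, (0, 0) + d ∈ templatePts ∨
      (0, 0) + d ∈ ({(0,-1), (1,0), (-1,1)} : Finset (ℤ × ℤ))) d hd).imp_right Or.inl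
  have near_one : ∀ p q (E : Finset (ℤ × ℤ)), p ∉ templatePts →
      (∀ s ∈ templatePts, (s.1 - p.1).natAbs < 7 ∧ (s.2 - p.2).natAbs < 7) → E.card ≤ 3 →
      (∀ d ∈ gridDirs, p + d ∈ templatePts ∨ p + d ∈ E ∨ p + d = q) →
      π q ∉ K → π p ∉ K := fun p q E hp hsmall hE h hq =>
    near_template p E hp hsmall hE fun d hd =>
      (h d hd).imp_right (Or.imp_right fun h => by rwa [h])
  have h10 : π (1, 0) ∉ K := near_one _ (0, 0) {(1, 1), (2, 0), (2, -1)} (by decide)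
    (by decide) (by decide) (by decide) h00
  have h0m1 : π (0, -1) ∉ K := near_one _ (0, 0) {(0, -2), (-1, -1), (1, -2)} (by decide)
    (by decide) (by decide) (by decide) h00
  have hm11 : π (-1, 1) ∉ K := near_one _ (0, 0) {(-1, 2), (-2, 1), (-2, 2)} (by decide)
    (by decide) (by decide) (by decide) h00
  have h11 : π (1, 1) ∉ K := near_one _ (1, 0) {(2, 1), (2, 0), (0, 2)} (by decide)
    (by decide) (by decide) (by decide) h10
  have h02 : π (0, 2) ∉ K := near_one _ (1, 1) {(0, 3), (-1, 2), (-1, 3)} (by decide)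
    (by decide) (by decide) (by decide) h11
  have hm12 : π (-1, 2) ∉ K := next _ _ _ (by decide) (by decide) (by decide) (by decide)
    (by decide) hm11 h02
  have h20 : π (2, 0) ∉ K := next _ _ _ (by decide) (by decide) (by decide) (by decide)
    (by decide) h10 h11
  have h2m1 : π (2, -1) ∉ K := next _ _ _ (by decide) (by decide) (by decide) (by decide)
    (by decide) h20 h10
  have h21 : π (2, 1) ∉ K := next _ _ _ (by decide) (by decide) (by decide) (by decide)
    (by decide) h11 h20
  have hm22 : π (-2, 2) ∉ K := next _ _ _ (by decide) (by decide) (by decide) (by decide)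
    (by decide) hm11 hm12
  have hm21 : π (-2, 1) ∉ K := next _ _ _ (by decide) (by decide) (by decide) (by decide)
    (by decide) hm11 hm22
  have h3m1 : π (3, -1) ∉ K := next _ _ _ (by decide) (by decide) (by decide) (by decide)
    (by decide) h2m1 h20
  have h3m2 : π (3, -2) ∉ K := next _ _ _ (by decide) (by decide) (by decide) (by decide)
    (by decide) h2m1 h3m1
  have h2m2 : π (2, -2) ∉ K := next _ _ _ (by decide) (by decide) (by decide) (by decide)
    (by decide) h2m1 h3m2
  have h1m2 : π (1, -2) ∉ K := next _ _ _ (by decide) (by decide) (by decide) (by decide)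
    (by decide) h0m1 h2m2
  have h0m2 : π (0, -2) ∉ K := next _ _ _ (by decide) (by decide) (by decide) (by decide)
    (by decide) h0m1 h1m2
  have hm1m1 : π (-1, -1) ∉ K := next _ _ _ (by decide) (by decide) (by decide) (by decide)
    (by decide) h0m1 h0m2
  have template_notMem : π (0, 1) ∉ K := by
    refine notMem_of_cover _ {(-2, 0), (1, 3), (2, 2), (0, 3)} (by decide) fun y hy hadj => ?_
    obtain ⟨u, v, hu, rfl, huv⟩ := exists_adj_of_identify_adj hadj
    have huS : u ∈ S := by
      rcases hu with rfl | hu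
      · exact ⟨(0, 1), by decide, rfl⟩
      · exact hu.1
    obtain ⟨s, hs, rfl⟩ := huS
    obtain ⟨d, hd, rfl⟩ := exists_gridDirs_of_adj huv
    rw [← map_add] at hy ⊢
    have cover : ∀ s ∈ templatePts, ∀ d ∈ gridDirs,
        s + d ∈ ({(-2, 0), (1, 3), (2, 2), (0, 3)} : Finset (ℤ × ℤ)) ∨
        s + d ∈ ({(-1, 1), (-1, -1), (0, 0), (0, -1), (-2, 1), (0, 2), (1, 1), (1, 0), (-1, 2), (1, -2), (2, -1), (2, -2), (2, 1)} : Finset (ℤ × ℤ)) := by decide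
    refine (cover s hs d hd).elim (fun h => ⟨_, h, rfl⟩) fun h => absurd hy ?_
    change π (s + d) ∉ K
    generalize s + d = q at h
    simp only [Finset.mem_insert, Finset.mem_singleton] at h
    rcases h with rfl | rfl | rfl | rfl | rfl | rfl | rfl | rfl | rfl | rfl | rfl | rfl | rfl <;> assumption
  obtain ⟨y, hy⟩ := hne
  obtain ⟨p, rfl⟩ := π_surj y
  refine forall_of_two_neighbors (P := fun p => π p ∉ K) (fun p d hd e he hde h h' => ?_)
    h00 h10 p hy
  by_cases hp : toTorus a b p ∈ S
  · obtain ⟨s, hs, hsp⟩ := hp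
    have : π p = π s := congrArg (Quot.mk _) hsp.symm
    rwa [this, π_template s hs]
  · exact two_neighbors p hp d hd e he hde h h'

/-- For `a, b ≥ 7`, the set `{(−1,0), (0,1), (1,−1), (1,2)}` is a
good 4-template in `T[a×b]`: it is independent and the identification is
4-degenerate. -/
theorem statement_7 (a b : ℕ) (ha : 7 ≤ a) (hb : 7 ≤ b) :
    GoodFourTemplate (triGrid a b)
      ({(-1, 0), (0, 1), (1, -1), (1, 2)} : Set (ZMod a × ZMod b)) := by
  rw [← toTorus_image_templatePts]
  refine ⟨?_, ?_, degenerate_identify_template ha hb⟩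
  · rintro _ ⟨p, hp, rfl⟩ _ ⟨q, hq, rfl⟩ hadj
    obtain ⟨d, hd, h⟩ := exists_gridDirs_of_adj hadj
    rw [← map_add] at h
    have far : ∀ p ∈ templatePts, ∀ q ∈ templatePts, ∀ d ∈ gridDirs, q ≠ p + d ∧
        (q.1 - (p + d).1).natAbs < 7 ∧ (q.2 - (p + d).2).natAbs < 7 := by decide
    have := far p hp q hq d hd
    exact this.1 (toTorus_eq_of_small ha hb h this.2)
  · have hinj : Set.InjOn (toTorus a b) templatePts := fun p hp q hq h =>
      toTorus_eq_of_small ha hb h ((by decide : ∀ p ∈ templatePts, ∀ q ∈ templatePts,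
        (p.1 - q.1).natAbs < 7 ∧ (p.2 - q.2).natAbs < 7) p hp q hq)
    rw [hinj.ncard_image, Set.ncard_coe_finset]
    decide

end KempePaper
end
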